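/- Let n be a positive integer and j an integer with 0 ≤ j ≤ n−1. Then, as an identity of Laurent polynomials in q: ∑_{k=j}^{n-1} (1-q^{2k+1}) [k+j choose 2j]_q q^{-(j+1)k} = ((1-q^{n})(1-q^{n-j})/(1-q^{j+1})) [n+j choose 2j]_q q^{-(j+1)(n-1)}. -/

import Mathlib

open Finset

/-- The q-Pochhammer symbol `(a;q)_n = ∏_{j=0}^{n-1} (1 - a q^j)`. -/
noncomputable def qPoch {F : Type*} [Field F] (q a : F) (n : ℕ) : F :=
  ∏ j ∈ Finset.range n, (1 - a * q ^ j)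

/-- The q-binomial coefficient `[n choose k]_q`, which is
`(q;q)_n / ((q;q)_k (q;q)_{n-k})` for `0 ≤ k ≤ n` and `0` otherwise. -/
noncomputable def qBin {F : Type*} [Field F] (q : F) (n k : ℕ) : F :=
  if k ≤ n then qPoch q q n / (qPoch q q k * qPoch q q (n - k)) else 0

/-- The q-Delannoy number `D_q(m,n) = ∑_{k=0}^n q^{k(k-1)/2} [n,k]_q [n+m-k,n]_q`. -/
noncomputable def Dq {F : Type*} [Field F] (q : F) (m n : ℕ) : F :=
  ∑ k ∈ Finset.range (n + 1), q ^ (k * (k - 1) / 2) * qBin q n k * qBin q (n + m - k) n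

/-- The q-Delannoy number of the second kind
`D*_q(m,n) = ∑_{k=0}^n q^{k(k+1)/2} [n,k]_q [n+m-k,n]_q`. -/
noncomputable def Dstar {F : Type*} [Field F] (q : F) (m n : ℕ) : F :=
  ∑ k ∈ Finset.range (n + 1), q ^ (k * (k + 1) / 2) * qBin q n k * qBin q (n + m - k) n

/-- The field of rational functions `ℚ(q)`. -/
abbrev Fq : Type := FractionRing (Polynomial ℚ)

noncomputable def q : Fq := algebraMap (Polynomial ℚ) Fq Polynomial.X

theorem q_ne_zero : q ≠ 0 := by
  unfold q
  simp

theorem one_sub_q_pow_ne (m : ℕ) : (1 : Fq) - q ^ (m + 1) ≠ 0 := by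
  intro h
  have h1 : algebraMap (Polynomial ℚ) Fq (1 - Polynomial.X ^ (m + 1)) = 0 := by
    rw [map_sub, map_one, map_pow]; exact h
  have h2 : (1 - Polynomial.X ^ (m + 1) : Polynomial ℚ) = 0 :=
    (IsFractionRing.injective (Polynomial ℚ) Fq) (by rw [h1, map_zero])
  have h3 := congrArg (Polynomial.eval 0) h2
  simp at h3

theorem qPoch_succ (m : ℕ) : qPoch q q (m + 1) = qPoch q q m * (1 - q ^ (m + 1)) := by
  unfold qPoch
  rw [Finset.prod_range_succ, pow_succ' q m]

theorem qPoch_ne (m : ℕ) : qPoch q q m ≠ 0 := by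
  induction m with
  | zero => simp [qPoch]
  | succ m ih => rw [qPoch_succ]; exact mul_ne_zero ih (one_sub_q_pow_ne m)

theorem qBin_self (a : ℕ) : qBin q a a = 1 := by
  unfold qBin
  have := qPoch_ne a
  have h0 : qPoch q q 0 = 1 := by simp [qPoch]
  simp [h0, this]

theorem qBin_step (a m : ℕ) :
    (1 - q ^ (m + 1)) * qBin q (a + m + 1) a = (1 - q ^ (a + m + 1)) * qBin q (a + m) a := by
  unfold qBin
  rw [if_pos (by omega), if_pos (by omega), show a + m + 1 - a = m + 1 by omega,
    show a + m - a = m by omega, qPoch_succ, qPoch_succ]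
  have h1 := qPoch_ne a
  have h2 := qPoch_ne m
  have h3 := one_sub_q_pow_ne m
  field_simp

theorem tele_aux (j m : ℕ) :
    ∑ k ∈ Finset.Icc j (j + m),
        (1 - q ^ (2 * k + 1)) * qBin q (k + j) (2 * j) * (q ^ ((j + 1) * k))⁻¹ =
    (1 - q ^ (j + m + 1)) / (1 - q ^ (j + 1)) *
      ((1 - q ^ (m + 1)) * qBin q (2 * j + m + 1) (2 * j)) * (q ^ ((j + 1) * (j + m)))⁻¹ := by
  induction m with
  | zero =>
    rw [qBin_step]
    have h := one_sub_q_pow_ne j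
    simp only [add_zero, Finset.Icc_self, Finset.sum_singleton]
    rw [← two_mul, div_self h, one_mul]
  | succ m ih =>
    rw [← add_assoc, Finset.sum_Icc_succ_top (by omega), ih,
      show 2 * j + (m + 1) + 1 = 2 * j + (m + 1) + 1 from rfl, qBin_step (2 * j) (m + 1),
      show j + m + 1 + j = 2 * j + (m + 1) by ring, show 2 * j + m + 1 = 2 * j + (m + 1) by ring,
      show (j + 1) * (j + m + 1) = (j + 1) * (j + m) + (j + 1) by ring, pow_add q ((j + 1) * (j + m))]
    have h := one_sub_q_pow_ne j
    have hQ : q ^ ((j + 1) * (j + m)) ≠ 0 := pow_ne_zero _ q_ne_zero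
    have hq : q ^ (j + 1) ≠ 0 := pow_ne_zero _ q_ne_zero
    generalize qBin q (2 * j + (m + 1)) (2 * j) = B
    generalize q ^ ((j + 1) * (j + m)) = Q at *
    have e : q ^ (j + 1) * (1 - q ^ (j + m + 1)) * (1 - q ^ (m + 1))
        + (1 - q ^ (2 * (j + m + 1) + 1)) * (1 - q ^ (j + 1))
        = (1 - q ^ (j + m + 1 + 1)) * (1 - q ^ (2 * j + (m + 1) + 1)) := by ring
    generalize q ^ (j + 1) = u at *
    generalize q ^ (j + m + 1) = v at *
    generalize q ^ (m + 1) = w at *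
    generalize q ^ (2 * (j + m + 1) + 1) = x at *
    generalize q ^ (j + m + 1 + 1) = y at *
    generalize q ^ (2 * j + (m + 1) + 1) = z at *
    field_simp
    linear_combination B * e

theorem telescoping_qbinom_sum (n j : ℕ) (hn : 0 < n) (hj : j ≤ n - 1) :
    ∑ k ∈ Finset.Icc j (n - 1),
        (1 - q ^ (2 * k + 1)) * qBin q (k + j) (2 * j) * (q ^ ((j + 1) * k))⁻¹ =
    (1 - q ^ n) * (1 - q ^ (n - j)) / (1 - q ^ (j + 1)) * qBin q (n + j) (2 * j) *
      (q ^ ((j + 1) * (n - 1)))⁻¹ := by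
  obtain ⟨m, rfl⟩ : ∃ m, n = j + m + 1 := ⟨n - 1 - j, by omega⟩
  rw [show j + m + 1 - 1 = j + m by omega, show j + m + 1 - j = m + 1 by omega, tele_aux,
    show j + m + 1 + j = 2 * j + m + 1 by ring]
  ring
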